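/- arXiv:1803.05679 — 4 statements merged into one kernel-verified Lean document; each statement's English description precedes it below -/
import Mathlib

section
/- Let a < b, let γ : [a,b] → ℂ be continuous and injective, and suppose γ is differentiable at some t₀ ∈ [a,b] with γ'(t₀) ≠ 0. Then for every δ ∈ (0,1) there exists ε > 0 such that for all z₁, z₂ ∈ D(γ(t₀), ε) ∩ γ([a,b]) with z₁, z₂, γ(t₀) pairwise distinct, the triangle Δ(z₁, γ(t₀), z₂) is δ-close to degenerate. -/
open Real Complex

/-- `𝒟(z₁,z₂,z₃)`: the maximum of the quotients `d_{j,k}/(d_{j,l}+d_{k,l})`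
over pairwise different `j,k,l ∈ {1,2,3}`. -/
noncomputable def triD (z₁ z₂ z₃ : ℂ) : ℝ :=
  max (max (dist z₁ z₂ / (dist z₁ z₃ + dist z₂ z₃))
           (dist z₁ z₃ / (dist z₁ z₂ + dist z₂ z₃)))
      (dist z₂ z₃ / (dist z₂ z₁ + dist z₃ z₁))

/-- A triangle with pairwise distinct vertices is `δ`-close to degenerate if some
quotient `d_{j,k}/(d_{j,l}+d_{k,l})` is at least `1 − δ`, i.e. `𝒟 ≥ 1 − δ`. -/
def CloseToDegenerate (δ : ℝ) (z₁ z₂ z₃ : ℂ) : Prop := 1 - δ ≤ triD z₁ z₂ z₃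

open Metric Set

section NearLine

variable {E : Type*} [NormedAddCommGroup E] [NormedSpace ℝ E] {v w w₁ w₂ : E} {s s₁ s₂ c δ : ℝ}

/-- A vector within `c * |s|` of `s • v` has norm comparable to `|s| * ‖v‖`. -/
lemma norm_bounds_of_near_smul (h : ‖w - s • v‖ ≤ c * |s|) :
    (‖v‖ - c) * |s| ≤ ‖w‖ ∧ ‖w‖ ≤ (‖v‖ + c) * |s| := by
  have h₁ := abs_le.1 (abs_norm_sub_norm_le w (s • v))
  rw [norm_smul, Real.norm_eq_abs] at h₁
  constructor <;> linarith [h₁.1, h₁.2]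

lemma abs_norm_sub_sub_le_of_near_smul (h₁ : ‖w₁ - s₁ • v‖ ≤ c * |s₁|)
    (h₂ : ‖w₂ - s₂ • v‖ ≤ c * |s₂|) :
    |‖w₁ - w₂‖ - |s₁ - s₂| * ‖v‖| ≤ c * (|s₁| + |s₂|) := by
  rw [← Real.norm_eq_abs (s₁ - s₂), ← norm_smul]
  calc |‖w₁ - w₂‖ - ‖(s₁ - s₂) • v‖| ≤ ‖w₁ - w₂ - (s₁ - s₂) • v‖ := abs_norm_sub_norm_le _ _
    _ = ‖(w₁ - s₁ • v) - (w₂ - s₂ • v)‖ := by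
      congr 1
      rw [sub_smul]
      abel
    _ ≤ ‖w₁ - s₁ • v‖ + ‖w₂ - s₂ • v‖ := norm_sub_le _ _
    _ ≤ c * (|s₁| + |s₂|) := by linarith

lemma mul_norm_add_norm_sub_le_of_near_smul (hδ : δ ∈ Ioo (0 : ℝ) 1)
    (h₁ : ‖w₁ - s₁ • v‖ ≤ δ / 4 * ‖v‖ * |s₁|) (h₂ : ‖w₂ - s₂ • v‖ ≤ δ / 4 * ‖v‖ * |s₂|)
    (hs : |s₁ - s₂| = |s₂| - |s₁|) :
    (1 - δ) * (‖w₁‖ + ‖w₁ - w₂‖) ≤ ‖w₂‖ := by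
  obtain ⟨hδ₀, hδ₁⟩ := hδ
  have hle : |s₁| ≤ |s₂| := by linarith [abs_nonneg (s₁ - s₂)]
  have hn₁ := (norm_bounds_of_near_smul h₁).2
  have hn₂ := (norm_bounds_of_near_smul h₂).1
  have hd := (abs_le.1 (abs_norm_sub_sub_le_of_near_smul h₁ h₂)).2
  rw [hs] at hd
  have hmul : δ * ‖v‖ * |s₁| ≤ δ * ‖v‖ * |s₂| := by gcongr
  have hsum : ‖w₁‖ + ‖w₁ - w₂‖ ≤ (1 + 3 * δ / 4) * (‖v‖ * |s₂|) := by linarith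
  calc (1 - δ) * (‖w₁‖ + ‖w₁ - w₂‖)
      ≤ (1 - δ) * ((1 + 3 * δ / 4) * (‖v‖ * |s₂|)) :=
        mul_le_mul_of_nonneg_left hsum (by linarith)
    _ = (1 - δ / 4 - 3 * δ ^ 2 / 4) * (‖v‖ * |s₂|) := by ring
    _ ≤ (1 - δ / 4) * (‖v‖ * |s₂|) := by
      refine mul_le_mul_of_nonneg_right ?_ (by positivity)
      nlinarith
    _ ≤ ‖w₂‖ := by linarith

lemma mul_norm_add_norm_le_of_near_smul (hδ : δ ∈ Ioo (0 : ℝ) 1)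
    (h₁ : ‖w₁ - s₁ • v‖ ≤ δ / 4 * ‖v‖ * |s₁|) (h₂ : ‖w₂ - s₂ • v‖ ≤ δ / 4 * ‖v‖ * |s₂|)
    (hs : |s₁ - s₂| = |s₁| + |s₂|) :
    (1 - δ) * (‖w₁‖ + ‖w₂‖) ≤ ‖w₁ - w₂‖ := by
  obtain ⟨hδ₀, hδ₁⟩ := hδ
  have hn₁ := (norm_bounds_of_near_smul h₁).2
  have hn₂ := (norm_bounds_of_near_smul h₂).2
  have hd := (abs_le.1 (abs_norm_sub_sub_le_of_near_smul h₁ h₂)).1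
  rw [hs] at hd
  have hsum : ‖w₁‖ + ‖w₂‖ ≤ (1 + δ / 4) * (‖v‖ * (|s₁| + |s₂|)) := by linarith
  calc (1 - δ) * (‖w₁‖ + ‖w₂‖)
      ≤ (1 - δ) * ((1 + δ / 4) * (‖v‖ * (|s₁| + |s₂|))) :=
        mul_le_mul_of_nonneg_left hsum (by linarith)
    _ = (1 - 3 * δ / 4 - δ ^ 2 / 4) * (‖v‖ * (|s₁| + |s₂|)) := by ring
    _ ≤ (1 - δ / 4) * (‖v‖ * (|s₁| + |s₂|)) := by
      refine mul_le_mul_of_nonneg_right ?_ (by positivity)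
      nlinarith
    _ ≤ ‖w₁ - w₂‖ := by linarith

end NearLine

lemma abs_sub_trichotomy (x y : ℝ) :
    |x - y| = |y| - |x| ∨ |x - y| = |x| - |y| ∨ |x - y| = |x| + |y| := by
  grind

lemma closeToDegenerate_of_near_smul {δ s₁ s₂ : ℝ} {v z₀ z₁ z₂ : ℂ} (hδ : δ ∈ Ioo (0 : ℝ) 1)
    (hz₁ : z₁ ≠ z₀) (hz₂ : z₂ ≠ z₀)
    (h₁ : ‖z₁ - z₀ - s₁ • v‖ ≤ δ / 4 * ‖v‖ * |s₁|)
    (h₂ : ‖z₂ - z₀ - s₂ • v‖ ≤ δ / 4 * ‖v‖ * |s₂|) :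
    CloseToDegenerate δ z₁ z₀ z₂ := by
  have hp₁ := dist_pos.2 hz₁
  have hp₂ := dist_pos.2 hz₂
  have hd₁ : ‖z₁ - z₀‖ = dist z₁ z₀ := (dist_eq_norm _ _).symm
  have hd₂ : ‖z₂ - z₀‖ = dist z₂ z₀ := (dist_eq_norm _ _).symm
  have hd₁₂ : ‖z₁ - z₀ - (z₂ - z₀)‖ = dist z₁ z₂ := by rw [dist_eq_norm, sub_sub_sub_cancel_right]
  unfold CloseToDegenerate triD
  rw [dist_comm z₀ z₁, dist_comm z₀ z₂, dist_comm z₂ z₁, le_max_iff, le_max_iff]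
  rcases abs_sub_trichotomy s₁ s₂ with hs | hs | hs
  · right
    have key := mul_norm_add_norm_sub_le_of_near_smul hδ h₁ h₂ hs
    rw [hd₁, hd₂, hd₁₂] at key
    rwa [le_div_iff₀ (by positivity)]
  · left; left
    have key := mul_norm_add_norm_sub_le_of_near_smul hδ h₂ h₁ (by rw [abs_sub_comm, hs])
    rw [norm_sub_rev (z₂ - z₀), hd₁, hd₂, hd₁₂] at key
    rw [le_div_iff₀ (by positivity)]
    linarith
  · left; right
    have key := mul_norm_add_norm_le_of_near_smul hδ h₁ h₂ hs
    rw [hd₁, hd₂, hd₁₂] at key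
    rwa [le_div_iff₀ (by positivity)]

/-- A continuous injective map on a compact set sends points far from `x` to points
far from the image of `x`. -/
lemma IsCompact.exists_forall_dist_lt_of_injOn {X Y : Type*} [PseudoMetricSpace X] [MetricSpace Y]
    {f : X → Y} {K : Set X} (hK : IsCompact K) (hf : ContinuousOn f K) (hinj : InjOn f K)
    {x : X} (hx : x ∈ K) {ρ : ℝ} (hρ : 0 < ρ) :
    ∃ ε > 0, ∀ y ∈ K, dist (f y) (f x) < ε → dist y x < ρ := by
  have hclosed : IsClosed (f '' (K \ ball x ρ)) :=
    ((hK.diff isOpen_ball).image_of_continuousOn (hf.mono sdiff_subset)).isClosed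
  have hmem : f x ∈ (f '' (K \ ball x ρ))ᶜ := by
    rintro ⟨y, ⟨hyK, hy⟩, hyx⟩
    rw [hinj hyK hx hyx] at hy
    exact hy (mem_ball_self hρ)
  obtain ⟨ε, hε, hsub⟩ := Metric.isOpen_iff.1 hclosed.isOpen_compl _ hmem
  refine ⟨ε, hε, fun y hyK hy => ?_⟩
  by_contra hfar
  exact hsub (mem_ball.2 hy) ⟨y, ⟨hyK, hfar⟩, rfl⟩

/-- If `γ : [a,b] → ℂ` is continuous and injective and differentiable at
`t₀ ∈ [a,b]` with `γ'(t₀) ≠ 0`, then for every `δ ∈ (0,1)` there is `ε > 0` such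
that for all `z₁, z₂ ∈ D(γ(t₀),ε) ∩ γ([a,b])` with `z₁, z₂, γ(t₀)` pairwise
distinct, the triangle `Δ(z₁, γ(t₀), z₂)` is `δ`-close to degenerate. -/
theorem stmt_4 (a b : ℝ) (hab : a < b) (γ : ℝ → ℂ)
    (hcont : ContinuousOn γ (Set.Icc a b)) (hinj : Set.InjOn γ (Set.Icc a b))
    (t₀ : ℝ) (ht₀ : t₀ ∈ Set.Icc a b) (γ' : ℂ) (hγ' : γ' ≠ 0)
    (hderiv : HasDerivWithinAt γ γ' (Set.Icc a b) t₀)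
    (δ : ℝ) (hδ : δ ∈ Set.Ioo (0 : ℝ) 1) :
    ∃ ε > 0, ∀ z₁ ∈ Metric.ball (γ t₀) ε ∩ γ '' Set.Icc a b,
      ∀ z₂ ∈ Metric.ball (γ t₀) ε ∩ γ '' Set.Icc a b,
        z₁ ≠ z₂ → z₁ ≠ γ t₀ → z₂ ≠ γ t₀ →
        CloseToDegenerate δ z₁ (γ t₀) z₂ := by
  have hδ₀ := hδ.1
  have hc : 0 < δ / 4 * ‖γ'‖ := by positivity
  have hlin := (hasDerivWithinAt_iff_isLittleO.1 hderiv).def hc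
  obtain ⟨ρ, hρ, hnear⟩ := Metric.mem_nhdsWithin_iff.1 hlin
  obtain ⟨ε, hε, hball⟩ :=
    isCompact_Icc.exists_forall_dist_lt_of_injOn hcont hinj ht₀ hρ
  refine ⟨ε, hε, ?_⟩
  rintro _ ⟨hb₁, t₁, ht₁, rfl⟩ _ ⟨hb₂, t₂, ht₂, rfl⟩ - hz₁ hz₂
  exact closeToDegenerate_of_near_smul hδ hz₁ hz₂
    (hnear ⟨hball t₁ ht₁ hb₁, ht₁⟩) (hnear ⟨hball t₂ ht₂ hb₂, ht₂⟩)
end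

section
/- Let h(z) = 5πz + 2πi·sin z. Then Re h'(z) > 0 for every z ∈ S_{-1,π/3}, and h is injective on S_{-1,π/3}. -/
open Real Complex

/-- `h(z) = 5πz + 2πi·sin z`. -/
noncomputable def h (z : ℂ) : ℂ := 5 * (π : ℂ) * z + 2 * (π : ℂ) * Complex.I * Complex.sin z

/-- The half-strip `S_{α,β} = {z : Re z > α, |Im z| < β}`. -/
def S (α β : ℝ) : Set ℂ := {z : ℂ | α < z.re ∧ |z.im| < β}

/-- Noshiro–Warschawski: a function whose derivative has positive real part on a convex set is
injective there. -/
theorem Convex.injOn_of_hasDerivAt_re_pos {s : Set ℂ} (hs : Convex ℝ s) {f f' : ℂ → ℂ}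
    (hf : ∀ z ∈ s, HasDerivAt f (f' z) z) (hpos : ∀ z ∈ s, 0 < (f' z).re) : Set.InjOn f s := by
  intro z hz w hw hzw
  by_contra hne
  have hsub : w - z ≠ 0 := sub_ne_zero.mpr (Ne.symm hne)
  have hmem : ∀ t ∈ Set.Icc (0 : ℝ) 1, z + (t : ℂ) * (w - z) ∈ s := fun t ht => by
    simpa using hs.add_smul_sub_mem hz hw ht
  have hderiv : ∀ t ∈ Set.Icc (0 : ℝ) 1,
      HasDerivAt (fun t : ℝ => ((starRingEnd ℂ) (w - z) * f (z + (t : ℂ) * (w - z))).re)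
        (Complex.normSq (w - z) * (f' (z + (t : ℂ) * (w - z))).re) t := fun t ht => by
    have hline : HasDerivAt (fun u : ℂ => z + u * (w - z)) (w - z) (t : ℂ) := by
      simpa using ((hasDerivAt_id (t : ℂ)).mul_const (w - z)).const_add z
    have hcomp := (((hf _ (hmem t ht)).comp (t : ℂ) hline).const_mul
      ((starRingEnd ℂ) (w - z))).real_of_complex
    refine hcomp.congr_deriv ?_
    rw [mul_left_comm, mul_comm ((starRingEnd ℂ) (w - z)), Complex.mul_conj, mul_comm,
      Complex.re_ofReal_mul]
  have hmono := strictMonoOn_of_deriv_pos (convex_Icc (0 : ℝ) 1)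
    (fun t ht => (hderiv t ht).continuousAt.continuousWithinAt) (fun t ht => by
      have ht' := interior_subset ht
      rw [(hderiv t ht').deriv]
      exact mul_pos (Complex.normSq_pos.mpr hsub) (hpos _ (hmem t ht')))
  have hlt := hmono (Set.left_mem_Icc.mpr zero_le_one) (Set.right_mem_Icc.mpr zero_le_one)
    zero_lt_one
  simp [hzw] at hlt

theorem convex_S (α β : ℝ) : Convex ℝ (S α β) := by
  have hS : S α β = {z : ℂ | α < z.re} ∩ ({z : ℂ | -β < z.im} ∩ {z : ℂ | z.im < β}) := by
    ext z
    simp [S, abs_lt]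
  rw [hS]
  exact (convex_halfSpace_re_gt α).inter
    ((convex_halfSpace_im_gt (-β)).inter (convex_halfSpace_im_lt β))

theorem hasDerivAt_h (z : ℂ) :
    HasDerivAt h (5 * (π : ℂ) + 2 * (π : ℂ) * Complex.I * Complex.cos z) z := by
  refine (((hasDerivAt_id z).const_mul (5 * (π : ℂ))).add
    ((Complex.hasDerivAt_sin z).const_mul (2 * (π : ℂ) * Complex.I))).congr_deriv ?_
  rw [mul_one]

theorem re_deriv_h (z : ℂ) :
    (5 * (π : ℂ) + 2 * (π : ℂ) * Complex.I * Complex.cos z).re =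
      π * (5 + 2 * (Real.sin z.re * Real.sinh z.im)) := by
  rw [Complex.cos_eq z]
  simp [Complex.sin_ofReal_re, Complex.sinh_ofReal_re]
  ring

theorem sinh_pi_div_three_lt : Real.sinh (π / 3) < 5 / 2 := by
  have hexp : Real.exp (3 / 2) < 5 := by
    refine lt_of_pow_lt_pow_left₀ 2 (by norm_num) ?_
    calc Real.exp (3 / 2) ^ 2 = Real.exp 1 ^ 3 := by
          rw [← Real.exp_nat_mul, ← Real.exp_nat_mul]; norm_num
      _ < 2.7182818286 ^ 3 := by gcongr; exact Real.exp_one_lt_d9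
      _ < 5 ^ 2 := by norm_num
  have hle : Real.exp (π / 3) ≤ Real.exp (3 / 2) :=
    Real.exp_le_exp.mpr (by linarith [Real.pi_le_four])
  rw [Real.sinh_eq]
  linarith [Real.exp_pos (-(π / 3))]

theorem re_deriv_h_pos {α : ℝ} {z : ℂ} (hz : z ∈ S α (π / 3)) :
    0 < (5 * (π : ℂ) + 2 * (π : ℂ) * Complex.I * Complex.cos z).re := by
  rw [re_deriv_h]
  have hsinh : |Real.sinh z.im| < 5 / 2 := by
    rw [Real.abs_sinh]
    exact (Real.sinh_lt_sinh.mpr hz.2).trans sinh_pi_div_three_lt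
  have hprod : |Real.sin z.re * Real.sinh z.im| < 5 / 2 := by
    rw [abs_mul]
    exact (mul_le_of_le_one_left (abs_nonneg _) (Real.abs_sin_le_one _)).trans_lt hsinh
  exact mul_pos Real.pi_pos (by linarith [(abs_lt.mp hprod).1])

/-- `Re h'(z) > 0` on `S_{-1,π/3}`, and `h` is injective on `S_{-1,π/3}`. -/
theorem stmt_7 :
    (∀ z ∈ S (-1) (π / 3), 0 < (deriv h z).re) ∧ Set.InjOn h (S (-1) (π / 3)) := by
  refine ⟨fun z hz => ?_, (convex_S _ _).injOn_of_hasDerivAt_re_pos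
    (fun z _ => hasDerivAt_h z) fun z hz => re_deriv_h_pos hz⟩
  rw [(hasDerivAt_h z).deriv]
  exact re_deriv_h_pos hz
end

section
/- Let h(z) = 5πz + 2πi·sin z. Then S_{0,π} ⊆ h(S_{-1,π/3}), i.e. for every w ∈ ℂ with Re w > 0 and |Im w| < π there exists z ∈ ℂ with Re z > −1 and |Im z| < π/3 such that h(z) = w. -/
open Real Complex

theorem norm_cos_le_cosh_im (z : ℂ) : ‖Complex.cos z‖ ≤ Real.cosh z.im := by
  have key : ‖Complex.exp (z * I) + Complex.exp (-z * I)‖ ≤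
      Real.exp (-z.im) + Real.exp z.im :=
    (norm_add_le _ _).trans_eq (by simp [Complex.norm_exp])
  rw [Complex.cos, norm_div, Real.cosh_eq, Complex.norm_ofNat]
  linarith

theorem norm_sin_le_cosh_im (z : ℂ) : ‖Complex.sin z‖ ≤ Real.cosh z.im := by
  have := norm_cos_le_cosh_im (z - π / 2)
  rw [Complex.cos_sub_pi_div_two] at this
  simpa using this

theorem cosh_le_of_abs_le_one {y : ℝ} (hy : |y| ≤ 1) : Real.cosh y ≤ 1.86 := by
  have hle : Real.cosh y ≤ Real.cosh 1 := Real.cosh_le_cosh.2 (by simpa using hy)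
  have h1 : Real.exp (-1) ≤ 1 := Real.exp_le_one_iff.2 (by norm_num)
  rw [Real.cosh_eq 1] at hle
  linarith [Real.exp_one_lt_d9]

theorem convex_abs_im_le (r : ℝ) : Convex ℝ {z : ℂ | |z.im| ≤ r} := by
  have : {z : ℂ | |z.im| ≤ r} = Complex.imLm ⁻¹' Set.Icc (-r) r := by
    ext z
    simp [abs_le]
  rw [this]
  exact (convex_Icc _ _).linear_preimage _

/-- The map `z ↦ (u - 2i·sin z) / 5` has a fixed point in the strip `|Im z| ≤ 1`. -/
theorem exists_fixedPoint_sub_sin (u : ℂ) (hu : |u.im| < 1) :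
    ∃ z : ℂ, |z.im| ≤ 1 ∧ (u - 2 * I * Complex.sin z) / 5 = z := by
  let g : ℂ → ℂ := fun z => (u - 2 * I * Complex.sin z) / 5
  let s : Set ℂ := {z | |z.im| ≤ 1}
  have hs : IsComplete s :=
    (isClosed_le (by fun_prop) continuous_const : IsClosed s).isComplete
  have hmaps : Set.MapsTo g s s := by
    intro z hz
    have hsin := (Complex.abs_re_le_norm _).trans
      ((norm_sin_le_cosh_im z).trans (cosh_le_of_abs_le_one hz))
    have him : (g z).im = (u.im - 2 * (Complex.sin z).re) / 5 := by
      simp [g]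
    change |(g z).im| ≤ 1
    rw [him]
    rw [abs_le] at hsin ⊢
    rw [abs_lt] at hu
    constructor <;> linarith
  have hderiv (z : ℂ) : HasDerivAt g (-(2 * I * Complex.cos z) / 5) z :=
    (((Complex.hasDerivAt_sin z).const_mul (2 * I)).const_sub u).div_const 5
  have hlip : LipschitzOnWith (3 / 4) g s := by
    refine (convex_abs_im_le 1).lipschitzOnWith_of_nnnorm_hasDerivWithin_le
      (fun z _ => (hderiv z).hasDerivWithinAt) fun z hz => ?_
    have hcos := (norm_cos_le_cosh_im z).trans (cosh_le_of_abs_le_one hz)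
    rw [← NNReal.coe_le_coe, coe_nnnorm]
    simp only [norm_div, norm_neg, norm_mul, Complex.norm_I, Complex.norm_ofNat]
    push_cast
    linarith
  have hcontr : ContractingWith (3 / 4) (hmaps.restrict g s s) :=
    ⟨by rw [← NNReal.coe_lt_coe]; norm_num, hlip.mapsToRestrict hmaps⟩
  obtain ⟨z, hz, hfix, -⟩ :=
    hcontr.exists_fixedPoint' hs hmaps (x := 0) (by simp [s]) (edist_ne_top _ _)
  exact ⟨z, hz, hfix⟩

/-- `S_{0,π} ⊆ h(S_{-1,π/3})`: for every `w` with `Re w > 0` and `|Im w| < π`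
there is `z` with `Re z > -1`, `|Im z| < π/3` and `h(z) = w`. -/
theorem stmt_8 : S 0 π ⊆ h '' S (-1) (π / 3) := by
  rintro w ⟨hre, him⟩
  have hu : |(w / π).im| < 1 := by
    rw [Complex.div_ofReal_im, abs_div, abs_of_pos pi_pos]
    exact (div_lt_one pi_pos).2 him
  obtain ⟨z, hz, hfix⟩ := exists_fixedPoint_sub_sin (w / π) hu
  refine ⟨z, ⟨?_, by linarith [pi_gt_three]⟩, ?_⟩
  · have hsin := (Complex.abs_im_le_norm _).trans
      ((norm_sin_le_cosh_im z).trans (cosh_le_of_abs_le_one hz))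
    have hzre : z.re = (w.re / π + 2 * (Complex.sin z).im) / 5 := by
      conv_lhs => rw [← hfix]
      simp
    have hpos : 0 < w.re / π := div_pos hre pi_pos
    rw [abs_le] at hsin
    linarith
  · have hpi : (π : ℂ) ≠ 0 := Complex.ofReal_ne_zero.2 pi_ne_zero
    have hz5 : w / π = 5 * z + 2 * I * Complex.sin z := by
      linear_combination 5 * hfix
    rw [div_eq_iff hpi] at hz5
    rw [h, hz5]
    ring
end

section
/- Every z ∈ T satisfies |Im z| ≤ 7/8; that is, if z ∈ ℂ with Re z > −1, |Im z| < π/3 and h(z) ∈ S_{0,π}, then |Im z| ≤ 7/8. -/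
open Real Complex

/-- The tract `T = {z ∈ S_{-1,π/3} : h(z) ∈ S_{0,π}}`. -/
noncomputable def T : Set ℂ := {z ∈ S (-1) (π / 3) | h z ∈ S 0 π}

theorem h_im (z : ℂ) :
    (h z).im = π * (5 * z.im + 2 * (Real.sin z.re * Real.cosh z.im)) := by
  have hs : (Complex.sin z).re = Real.sin z.re * Real.cosh z.im := by
    rw [Complex.sin_eq]
    simp [Complex.sin_ofReal_re]
  have he : h z = ((5 * π : ℝ) : ℂ) * z + ((2 * π : ℝ) : ℂ) * (Complex.I * Complex.sin z) := by
    rw [h]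
    push_cast
    ring
  rw [he, Complex.add_im, Complex.im_ofReal_mul, Complex.im_ofReal_mul, Complex.I_mul_im, hs]
  ring

theorem cosh_le_of_abs_lt_pi_div_three {y : ℝ} (hy : |y| < π / 3) :
    Real.cosh y ≤ 27 / 16 := by
  have hy' : |y| ≤ 1.0472 := by linarith [Real.pi_lt_d4]
  have hsq : y ^ 2 ≤ 1.0472 ^ 2 := by
    rw [← sq_abs]
    gcongr
  have hs : (y / 2) ^ 2 / 2 ≤ 0.1371 := by nlinarith
  have hexp : Real.cosh (y / 2) ≤ 1.159 := by
    have h1 := Real.cosh_le_exp_half_sq (y / 2)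
    have h2 := Real.add_one_le_exp (-((y / 2) ^ 2 / 2))
    have h3 : Real.exp ((y / 2) ^ 2 / 2) * Real.exp (-((y / 2) ^ 2 / 2)) = 1 := by
      rw [← Real.exp_add, add_neg_cancel, Real.exp_zero]
    nlinarith [Real.exp_pos ((y / 2) ^ 2 / 2)]
  have hd : Real.cosh y = 2 * Real.cosh (y / 2) ^ 2 - 1 := by
    have h1 := Real.cosh_two_mul (y / 2)
    rw [mul_div_cancel₀ y two_ne_zero] at h1
    linarith [Real.cosh_sq (y / 2)]
  nlinarith [Real.one_le_cosh (y / 2)]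

/-- Every `z ∈ T` satisfies `|Im z| ≤ 7/8`. -/
theorem stmt_9 (z : ℂ) (hz : z ∈ T) : |z.im| ≤ 7 / 8 := by
  obtain ⟨⟨-, hy⟩, -, him⟩ := hz
  have hc := cosh_le_of_abs_lt_pi_div_three hy
  rw [h_im, abs_mul, abs_of_pos Real.pi_pos, mul_lt_iff_lt_one_right Real.pi_pos] at him
  have hsc : |Real.sin z.re * Real.cosh z.im| ≤ 27 / 16 := by
    rw [abs_mul, abs_of_pos (Real.cosh_pos _)]
    nlinarith [Real.abs_sin_le_one z.re, Real.cosh_pos z.im]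
  rw [abs_lt] at him
  rw [abs_le] at hsc ⊢
  constructor <;> linarith
end
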